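/- arXiv:1112.4574 — 4 statements merged into one kernel-verified Lean document; each statement's English description precedes it below -/
import Mathlib

section
/- Let G be a countable discrete group acting continuously on a Hausdorff topological space M. The stabilizer mapping St_A : M → Sub(G) is continuous at a point x ∈ M if and only if the stabilizer of x coincides with its neighborhood stabilizer: St°_A(x) = St_A(x). -/
/- The space `Sub(G)` of subgroups of a countable group `G`, topologized via the
embedding `H ↦ χ_H` into `{0,1}^G = G → Bool` with the product topology.
For a continuous action of `G` on a topological space `M`, `St_A(x)` is the stabilizer
of `x` and the neighborhood stabilizer `St°_A(x)` is the set of all `g ∈ G` fixing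
pointwise some neighborhood of `x`. -/

open scoped Classical

/-- The indicator function `χ_H : G → {0,1}` of a subgroup `H`. -/
noncomputable def chi {G : Type*} [Group G] (H : Subgroup G) : G → Bool :=
  fun g => decide (g ∈ H)

/-- The topology on `Sub(G)` induced by the embedding `H ↦ χ_H` into `{0,1}^G`. -/
noncomputable instance subgroupSpaceTopology {G : Type*} [Group G] :
    TopologicalSpace (Subgroup G) :=
  TopologicalSpace.induced chi inferInstance

/-- The neighborhood stabilizer `St°_A(x)`: all `g ∈ G` whose action fixes pointwise
some neighborhood of `x` (the neighborhood may depend on `g`). -/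
def nbhdStabilizer (G : Type*) {M : Type*} [Group G] [MulAction G M]
    [TopologicalSpace M] (x : M) : Set G :=
  {g : G | ∃ U ∈ nhds x, ∀ y ∈ U, g • y = y}

/-- For a continuous action of a countable discrete group `G` on a Hausdorff space `M`,
the stabilizer map `St_A : M → Sub(G)` is continuous at `x` if and only if
`St°_A(x) = St_A(x)`. -/
theorem stabilizer_map_continuousAt_iff (G M : Type*) [Group G] [Countable G]
    [TopologicalSpace M] [T2Space M] [MulAction G M]
    (hc : ∀ g : G, Continuous fun x : M => g • x) (x : M) :
    ContinuousAt (fun y : M => MulAction.stabilizer G y) x ↔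
      nbhdStabilizer G x = ↑(MulAction.stabilizer G x) := by
  have key : ContinuousAt (fun y : M => MulAction.stabilizer G y) x ↔
      ∀ g : G, ∀ᶠ y in nhds x, (g • y = y ↔ g • x = x) := by
    have hi : Topology.IsInducing (chi : Subgroup G → G → Bool) := ⟨rfl⟩
    rw [hi.continuousAt_iff, continuousAt_pi]
    refine forall_congr' fun g => ?_
    rw [ContinuousAt, nhds_discrete Bool, Filter.tendsto_pure]
    refine Filter.eventually_congr (Filter.Eventually.of_forall fun y => ?_)
    simp [chi, MulAction.mem_stabilizer_iff]
  rw [key]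
  constructor
  · intro h
    ext g
    constructor
    · rintro ⟨U, hU, hg⟩
      exact hg x (mem_of_mem_nhds hU)
    · intro hg
      have hg' : g • x = x := hg
      exact ⟨_, h g, fun y hy => hy.2 hg'⟩
  · intro h g
    by_cases hg : g • x = x
    · have hm : g ∈ nbhdStabilizer G x := by
        rw [h]
        exact hg
      obtain ⟨U, hU, hf⟩ := hm
      filter_upwards [hU] with y hy
      exact ⟨fun _ => hg, fun _ => hf y hy⟩
    · have ho : IsOpen {y : M | g • y ≠ y} := isOpen_ne_fun (hc g) continuous_id
      filter_upwards [ho.mem_nhds hg] with y hy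
      exact ⟨fun e => absurd e hy, fun e => absurd e hg⟩
end

section
/- Let G be a countable discrete group acting continuously on a Hausdorff topological space M. If a sequence of points x₁, x₂, … in M converges to a point x, and the sequence of stabilizers St_A(x₁), St_A(x₂), … converges in Sub(G) to a subgroup H, then St°_A(x) ⊆ H ⊆ St_A(x). -/
/- The space `Sub(G)` of subgroups of a countable group `G`, topologized via the
embedding `H ↦ χ_H` into `{0,1}^G = G → Bool` with the product topology.
For a continuous action of `G` on a topological space `M`, `St_A(x)` is the stabilizer
of `x` and the neighborhood stabilizer `St°_A(x)` is the set of all `g ∈ G` fixing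
pointwise some neighborhood of `x`. -/

open scoped Classical

/-- If points `x₁, x₂, …` converge to `x` in `M` and their stabilizers converge in
`Sub(G)` to a subgroup `H`, then `St°_A(x) ⊆ H ⊆ St_A(x)`. -/
theorem stabilizer_limit_squeeze (G M : Type*) [Group G] [Countable G]
    [TopologicalSpace M] [T2Space M] [MulAction G M]
    (hc : ∀ g : G, Continuous fun x : M => g • x)
    (x : ℕ → M) (p : M) (H : Subgroup G)
    (hx : Filter.Tendsto x Filter.atTop (nhds p))
    (hst : Filter.Tendsto (fun n => MulAction.stabilizer G (x n)) Filter.atTop (nhds H)) :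
    nbhdStabilizer G p ⊆ ↑H ∧ H ≤ MulAction.stabilizer G p := by
  have key : ∀ g : G, ∀ᶠ n in Filter.atTop, (g • x n = x n ↔ g ∈ H) := by
    intro g
    have h1 : Filter.Tendsto (fun n => chi (MulAction.stabilizer G (x n))) Filter.atTop
        (nhds (chi H)) := (continuous_induced_dom.tendsto H).comp hst
    have h2 := (tendsto_pi_nhds.1 h1) g
    rw [nhds_discrete, Filter.tendsto_pure] at h2
    filter_upwards [h2] with n hn
    simpa [chi, MulAction.mem_stabilizer_iff] using hn
  constructor
  · rintro g ⟨U, hU, hg⟩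
    obtain ⟨n, h1, h2⟩ := ((key g).and (hx hU)).exists
    exact h1.1 (hg _ h2)
  · intro g hg
    rw [MulAction.mem_stabilizer_iff]
    have h1 : Filter.Tendsto (fun n => g • x n) Filter.atTop (nhds (g • p)) :=
      ((hc g).tendsto p).comp hx
    refine tendsto_nhds_unique (h1.congr' ?_) hx
    filter_upwards [key g] with n hn
    exact hn.2 hg
end

section
/- Let X be a finite alphabet and G a countable group of automorphisms of the regular rooted tree on X*, acting on the boundary X^ℕ by the induced action β. Assume that for any ξ, η ∈ X^ℕ either St_β(ξ) = St_β(η) or St_β(ξ) is not contained in St_β(η). Then the mapping St_β : X^ℕ → Sub(G) maps every open set, every closed set, and every intersection of an open set with a closed set onto a Borel subset of Sub(G). -/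
/- Setup: `X*` is modelled by `List X`; a countable group `G` acts on `X*` by
automorphisms of the regular rooted tree (bijections preserving word lengths and
lengths of longest common prefixes) and on the boundary `X^ℕ = ℕ → X` (product
topology, `X` discrete) by the induced action `β`: the length-`n` prefix of `g • ξ`
equals `g` applied to the length-`n` prefix of `ξ`.  `Sub(G)` is topologized via the
embedding `H ↦ χ_H` into `{0,1}^G`, and carries the Borel σ-algebra. -/

open scoped Classical

/-- The length of the longest common prefix (common beginning) of two words. -/
def lcpLength {X : Type*} [DecidableEq X] : List X → List X → ℕ
  | a :: s, b :: t => if a = b then lcpLength s t + 1 else 0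
  | _, _ => 0

theorem isClopen_mem_subgroup {G : Type*} [Group G] (g : G) :
    IsClopen {H : Subgroup G | g ∈ H} := by
  have hc : Continuous (fun H : Subgroup G => chi H g) := by
    have h1 : Continuous (chi : Subgroup G → G → Bool) := continuous_induced_dom
    exact (continuous_apply g).comp h1
  have h : {H : Subgroup G | g ∈ H} = (fun H : Subgroup G => chi H g) ⁻¹' {true} := by
    ext H
    simp [chi]
  rw [h]
  exact (isClopen_discrete _).preimage hc

theorem isClosed_fix_of_comp {X G : Type*} [Finite X]
    [TopologicalSpace X] [DiscreteTopology X]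
    [Group G] [MulAction G (List X)] [MulAction G (ℕ → X)]
    (hcomp : ∀ (g : G) (ξ : ℕ → X) (n : ℕ),
        (List.ofFn fun i : Fin n => (g • ξ) i) = g • (List.ofFn fun i : Fin n => ξ i))
    (g : G) : IsClosed {ξ : ℕ → X | g • ξ = ξ} := by
  have h : {ξ : ℕ → X | g • ξ = ξ} = ⋂ n : ℕ, (fun (ξ : ℕ → X) (i : Fin n) => ξ i) ⁻¹'
      {v | g • List.ofFn v = List.ofFn v} := by
    ext ξ
    simp only [Set.mem_ofPred_eq, Set.mem_iInter, Set.mem_preimage]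
    constructor
    · intro h n
      rw [← hcomp, h]
    · intro h
      funext n
      have h1 := h (n + 1)
      rw [← hcomp] at h1
      have h2 := congrFun (List.ofFn_injective h1) (Fin.last n)
      simpa using h2
  rw [h]
  refine isClosed_iInter fun n => IsClosed.preimage ?_ (isClosed_discrete _)
  exact continuous_pi fun i => continuous_apply _

theorem isClosed_sub_stabilizer {X G : Type*} [Finite X]
    [TopologicalSpace X] [DiscreteTopology X]
    [Group G] [MulAction G (ℕ → X)]
    (hfix : ∀ g : G, IsClosed {ξ : ℕ → X | g • ξ = ξ})
    (C : Set (ℕ → X)) (hC : IsClosed C) :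
    IsClosed {H : Subgroup G | ∃ η ∈ C, H ≤ MulAction.stabilizer G η} := by
  have hS : IsClosed {p : Subgroup G × (ℕ → X) |
      p.2 ∈ C ∧ ∀ g : G, g ∉ p.1 ∨ g • p.2 = p.2} := by
    refine IsClosed.inter (hC.preimage continuous_snd) ?_
    have he : {p : Subgroup G × (ℕ → X) | ∀ g : G, g ∉ p.1 ∨ g • p.2 = p.2} =
        ⋂ g : G, {p : Subgroup G × (ℕ → X) | g ∉ p.1 ∨ g • p.2 = p.2} := by
      ext p
      simp
    change IsClosed {p : Subgroup G × (ℕ → X) | ∀ g : G, g ∉ p.1 ∨ g • p.2 = p.2}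
    rw [he]
    refine isClosed_iInter fun g => IsClosed.union ?_ ((hfix g).preimage continuous_snd)
    exact ((isClopen_mem_subgroup g).compl.isClosed).preimage continuous_fst
  have h := isClosedMap_fst_of_compactSpace _ hS
  convert h using 1
  ext H
  simp only [Set.mem_ofPred_eq, Set.mem_image, Prod.exists, exists_and_right, exists_eq_right]
  refine exists_congr fun η => and_congr_right fun _ => ?_
  refine forall_congr' fun g => ?_
  rw [MulAction.mem_stabilizer_iff, imp_iff_not_or]

/-- Assume that for any `ξ, η ∈ X^ℕ`, either `St_β(ξ) = St_β(η)` or `St_β(ξ)` is not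
contained in `St_β(η)`.  Then `St_β` maps every open set, every closed set, and every
intersection of an open set with a closed set onto a Borel subset of `Sub(G)`. -/
theorem stabilizer_map_images_borel (X G : Type*) [Finite X] [DecidableEq X]
    [TopologicalSpace X] [DiscreteTopology X]
    [Group G] [Countable G] [MulAction G (List X)] [MulAction G (ℕ → X)]
    (hfaith : ∀ g : G, (∀ w : List X, g • w = w) → g = 1)
    (hlen : ∀ (g : G) (w : List X), (g • w).length = w.length)
    (hlcp : ∀ (g : G) (w₁ w₂ : List X), lcpLength (g • w₁) (g • w₂) = lcpLength w₁ w₂)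
    (hcomp : ∀ (g : G) (ξ : ℕ → X) (n : ℕ),
        (List.ofFn fun i : Fin n => (g • ξ) i) = g • (List.ofFn fun i : Fin n => ξ i))
    (hdich : ∀ ξ η : ℕ → X, MulAction.stabilizer G ξ = MulAction.stabilizer G η ∨
        ¬ (MulAction.stabilizer G ξ ≤ MulAction.stabilizer G η)) :
    ∀ U C : Set (ℕ → X), IsOpen U → IsClosed C →
      @MeasurableSet (Subgroup G) (borel (Subgroup G))
          ((fun ξ : ℕ → X => MulAction.stabilizer G ξ) '' U) ∧
      @MeasurableSet (Subgroup G) (borel (Subgroup G))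
          ((fun ξ : ℕ → X => MulAction.stabilizer G ξ) '' C) ∧
      @MeasurableSet (Subgroup G) (borel (Subgroup G))
          ((fun ξ : ℕ → X => MulAction.stabilizer G ξ) '' (U ∩ C)) := by
  have hfix := isClosed_fix_of_comp (X := X) (G := G) hcomp
  letI : MeasurableSpace (Subgroup G) := borel (Subgroup G)
  haveI : BorelSpace (Subgroup G) := ⟨rfl⟩
  have key : ∀ C : Set (ℕ → X), IsClosed C →
      MeasurableSet ((fun ξ : ℕ → X => MulAction.stabilizer G ξ) '' C) := by
    intro C hC
    have h : (fun ξ : ℕ → X => MulAction.stabilizer G ξ) '' C =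
        {H : Subgroup G | ∃ η ∈ C, H ≤ MulAction.stabilizer G η} ∩
        ⋂ g : G, ({H : Subgroup G | g ∈ H} ∪
          {H : Subgroup G | ∃ η ∈ {ξ : ℕ → X | g • ξ = ξ},
            H ≤ MulAction.stabilizer G η}ᶜ) := by
      ext H
      simp only [Set.mem_image, Set.mem_inter_iff, Set.mem_iInter, Set.mem_union,
        Set.mem_compl_iff, Set.mem_ofPred_eq]
      constructor
      · rintro ⟨ξ, hξ, rfl⟩
        refine ⟨⟨ξ, hξ, le_rfl⟩, fun g => ?_⟩
        by_contra hcon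
        push Not at hcon
        obtain ⟨hg, η, hη, hle⟩ := hcon
        rcases hdich ξ η with h | h
        · exact hg (h ▸ hη)
        · exact h hle
      · rintro ⟨⟨η, hη, hle⟩, hall⟩
        refine ⟨η, hη, le_antisymm (fun g hg => ?_) hle⟩
        rcases hall g with h | h
        · exact h
        · exact absurd ⟨η, hg, hle⟩ h
    rw [h]
    refine (isClosed_sub_stabilizer hfix C hC).measurableSet.inter ?_
    refine MeasurableSet.iInter fun g => ?_
    exact (isClopen_mem_subgroup g).isClosed.measurableSet.union
      (isClosed_sub_stabilizer hfix _ (hfix g)).measurableSet.compl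
  have key2 : ∀ U C : Set (ℕ → X), IsOpen U → IsClosed C →
      MeasurableSet ((fun ξ : ℕ → X => MulAction.stabilizer G ξ) '' (U ∩ C)) := by
    intro U C hU hC
    letI : MetricSpace (ℕ → X) := TopologicalSpace.metrizableSpaceMetric _
    obtain ⟨F, hF, -, hFU, -⟩ := hU.exists_iUnion_isClosed
    rw [← hFU, Set.iUnion_inter, Set.image_iUnion]
    exact MeasurableSet.iUnion fun n => key _ ((hF n).inter hC)
  intro U C hU hC
  refine ⟨?_, key C hC, key2 U C hU hC⟩
  simpa using key2 U Set.univ hU isClosed_univ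
end

section
/- Let X be a finite alphabet and G a countable group of automorphisms of the regular rooted tree on X*, acting on the boundary X^ℕ by the induced action β. Assume that for any ξ, η ∈ X^ℕ either St_β(ξ) = St_β(η) or St_β(ξ) is not contained in St_β(η), and that the mapping St_β is finite-to-one (the preimage of every subgroup is finite). Then St_β maps every Borel subset of X^ℕ onto a Borel subset of Sub(G). -/
/- Setup: `X*` is modelled by `List X`; a countable group `G` acts on `X*` by
automorphisms of the regular rooted tree (bijections preserving word lengths and
lengths of longest common prefixes) and on the boundary `X^ℕ = ℕ → X` (product
topology, `X` discrete) by the induced action `β`: the length-`n` prefix of `g • ξ`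
equals `g` applied to the length-`n` prefix of `ξ`.  `Sub(G)` is topologized via the
embedding `H ↦ χ_H` into `{0,1}^G`; both `X^ℕ` and `Sub(G)` carry Borel σ-algebras. -/

open scoped Classical

/-- Each group element acts continuously on the boundary. -/
theorem aux_continuous_smul {X G : Type*} [TopologicalSpace X] [DiscreteTopology X]
    [Group G] [MulAction G (List X)] [MulAction G (ℕ → X)]
    (hcomp : ∀ (g : G) (ξ : ℕ → X) (n : ℕ),
        (List.ofFn fun i : Fin n => (g • ξ) i) = g • (List.ofFn fun i : Fin n => ξ i))
    (g : G) : Continuous (fun ξ : ℕ → X => g • ξ) := by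
  refine continuous_pi fun n => ?_
  refine continuous_iff_continuousAt.2 fun ξ => ?_
  have hev : ∀ᶠ η in nhds ξ, (g • η) n = (g • ξ) n := by
    have h1 : ∀ᶠ η in nhds ξ, ∀ i : Fin (n + 1), η i = ξ i := by
      refine Filter.eventually_all.2 fun i => ?_
      have hc : Continuous (fun η : ℕ → X => η (i : ℕ)) := continuous_apply _
      exact hc.continuousAt.eventually (p := fun x => x = ξ i) (by simp [nhds_discrete])
    filter_upwards [h1] with η hη
    have h2 : (fun i : Fin (n + 1) => η i) = fun i : Fin (n + 1) => ξ i := funext hη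
    have h3 := hcomp g η (n + 1)
    rw [h2, ← hcomp g ξ (n + 1)] at h3
    have h4 := List.ofFn_injective h3
    exact congrFun h4 (Fin.last n)
  exact (continuousAt_const (y := (g • ξ) n)).congr (hev.mono fun η h => h.symm)

theorem aux_chi_injective {G : Type*} [Group G] :
    Function.Injective (chi : Subgroup G → G → Bool) := by
  intro H K h
  ext g
  have := congrFun h g
  simpa [chi] using this

/-- Assume that for any `ξ, η ∈ X^ℕ`, either `St_β(ξ) = St_β(η)` or `St_β(ξ)` is not
contained in `St_β(η)`, and that `St_β` is finite-to-one.  Then `St_β` maps every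
Borel subset of `X^ℕ` onto a Borel subset of `Sub(G)`. -/
theorem stabilizer_map_borel_images (X G : Type*) [Finite X] [DecidableEq X]
    [TopologicalSpace X] [DiscreteTopology X]
    [Group G] [Countable G] [MulAction G (List X)] [MulAction G (ℕ → X)]
    (hfaith : ∀ g : G, (∀ w : List X, g • w = w) → g = 1)
    (hlen : ∀ (g : G) (w : List X), (g • w).length = w.length)
    (hlcp : ∀ (g : G) (w₁ w₂ : List X), lcpLength (g • w₁) (g • w₂) = lcpLength w₁ w₂)
    (hcomp : ∀ (g : G) (ξ : ℕ → X) (n : ℕ),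
        (List.ofFn fun i : Fin n => (g • ξ) i) = g • (List.ofFn fun i : Fin n => ξ i))
    (hdich : ∀ ξ η : ℕ → X, MulAction.stabilizer G ξ = MulAction.stabilizer G η ∨
        ¬ (MulAction.stabilizer G ξ ≤ MulAction.stabilizer G η))
    (hfin : ∀ H : Subgroup G, {ξ : ℕ → X | MulAction.stabilizer G ξ = H}.Finite) :
    ∀ B : Set (ℕ → X), @MeasurableSet (ℕ → X) (borel (ℕ → X)) B →
      @MeasurableSet (Subgroup G) (borel (Subgroup G))
        ((fun ξ : ℕ → X => MulAction.stabilizer G ξ) '' B) := by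
  intro B hB
  borelize (ℕ → X)
  borelize (Subgroup G)
  have hind : Topology.IsInducing (chi : Subgroup G → G → Bool) := ⟨rfl⟩
  have hemb : Topology.IsEmbedding (chi : Subgroup G → G → Bool) := ⟨hind, aux_chi_injective⟩
  have : T2Space (Subgroup G) := hemb.t2Space
  have : SecondCountableTopology (Subgroup G) := hemb.secondCountableTopology
  have hfix : ∀ g : G, IsClosed {ξ : ℕ → X | g • ξ = ξ} := fun g =>
    isClosed_eq (aux_continuous_smul hcomp g) continuous_id
  -- measurability of the stabilizer map
  have hmeas : Measurable (fun ξ : ℕ → X => MulAction.stabilizer G ξ) := by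
    have hms : borel (Subgroup G) = MeasurableSpace.comap chi (borel (G → Bool)) :=
      borel_comap
    have h1 : Measurable (fun ξ : ℕ → X => chi (MulAction.stabilizer G ξ)) := by
      refine measurable_pi_iff.2 fun g => ?_
      have : MeasurableSet {ξ : ℕ → X | g • ξ = ξ} := (hfix g).measurableSet
      refine measurable_to_bool ?_
      convert this using 1
      ext ξ
      simp [chi, MulAction.mem_stabilizer_iff]
    intro S hS
    rw [BorelSpace.measurable_eq (α := Subgroup G), hms] at hS
    obtain ⟨T, hT, rfl⟩ := hS
    rw [← BorelSpace.measurable_eq (α := G → Bool)] at hT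
    exact h1 hT
  -- disjointness of the fixed point set from a clopen set is a Borel condition
  let F : (ℕ → X) → Set (ℕ → X) := fun ξ => {η | ∀ g : G, g • ξ = ξ → g • η = η}
  have hF : ∀ ξ η, η ∈ F ξ ↔ MulAction.stabilizer G ξ = MulAction.stabilizer G η := by
    intro ξ η
    constructor
    · intro h
      exact (hdich ξ η).resolve_right (fun hn => hn fun g hg => h g hg)
    · intro h g hg
      have : g ∈ MulAction.stabilizer G ξ := hg
      rw [h] at this
      exact this
  have hdisj : ∀ V : Set (ℕ → X), IsClosed V → MeasurableSet {ξ | F ξ ∩ V = ∅} := by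
    intro V hV
    have heq : {ξ | F ξ ∩ V = ∅} = ⋃ T : Finset G,
        {ξ | (∀ g ∈ T, g • ξ = ξ) ∧ V ∩ ⋂ g ∈ T, {η : ℕ → X | g • η = η} = ∅} := by
      ext ξ
      simp only [Set.mem_ofPred_eq, Set.mem_iUnion]
      constructor
      · intro h
        obtain ⟨u, hu⟩ := hV.isCompact.elim_finite_subfamily_closed
          (fun g : MulAction.stabilizer G ξ => {η : ℕ → X | (g : G) • η = η})
          (fun g => hfix g) (by
            rw [Set.eq_empty_iff_forall_notMem] at h ⊢
            rintro η ⟨h1, h2⟩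
            refine h η ⟨fun g hg => ?_, h1⟩
            exact Set.mem_iInter.1 h2 ⟨g, hg⟩)
        refine ⟨u.image Subtype.val, ?_, ?_⟩
        · intro g hg
          obtain ⟨g', -, rfl⟩ := Finset.mem_image.1 hg
          exact g'.2
        · rw [← hu]
          congr 1
          ext η
          simp
      · rintro ⟨T, hT, hE⟩
        rw [Set.eq_empty_iff_forall_notMem] at hE ⊢
        rintro η ⟨h1, h2⟩
        exact hE η ⟨h2, Set.mem_iInter₂.2 fun g hg => h1 g (hT g hg)⟩
    rw [heq]
    refine MeasurableSet.iUnion fun T => ?_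
    refine MeasurableSet.inter (s₁ := {ξ | ∀ g ∈ T, g • ξ = ξ}) ?_ (MeasurableSet.const _)
    have : {ξ : ℕ → X | ∀ g ∈ T, g • ξ = ξ} = ⋂ g ∈ T, {ξ : ℕ → X | g • ξ = ξ} := by
      ext ξ; simp
    rw [this]
    exact (isClosed_biInter fun g _ => hfix g).measurableSet
  have : Countable (TopologicalSpace.Clopens (ℕ → X)) :=
    TopologicalSpace.Clopens.countable_iff_secondCountable.2 inferInstance
  let A : TopologicalSpace.Clopens (ℕ → X) → Set (ℕ → X) := fun U =>
    (U : Set (ℕ → X)) ∩ ⋂ V : TopologicalSpace.Clopens (ℕ → X),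
      {ξ | (V : Set (ℕ → X)) ⊆ U → ξ ∈ (V : Set (ℕ → X)) ∨ F ξ ∩ V = ∅}
  have hAm : ∀ U, MeasurableSet (A U) := by
    intro U
    refine U.isClopen.isClosed.measurableSet.inter (MeasurableSet.iInter fun V => ?_)
    by_cases hVU : (V : Set (ℕ → X)) ⊆ U
    · simp only [hVU, true_imp_iff]
      exact V.isClopen.isClosed.measurableSet.union (hdisj V V.isClopen.isClosed)
    · simp [hVU]
  have hbasis := isTopologicalBasis_isClopen (X := ℕ → X)
  have hAF : ∀ U, ∀ ξ ∈ A U, ∀ η ∈ F ξ, η ∈ (U : Set (ℕ → X)) → η = ξ := by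
    intro U ξ hξ η hη hηU
    by_contra hne
    obtain ⟨V, hV, hηV, hVs⟩ := hbasis.exists_subset_of_mem_open
      (show η ∈ (U : Set (ℕ → X)) ∩ {ξ}ᶜ from ⟨hηU, hne⟩)
      (U.isClopen.isOpen.inter isOpen_compl_singleton)
    have hV' : IsClopen V := hV
    rcases Set.mem_iInter.1 hξ.2 ⟨V, hV'⟩ (fun x hx => (hVs hx).1) with h | h
    · exact (hVs h).2 rfl
    · exact (Set.eq_empty_iff_forall_notMem.1 h) η ⟨hη, hηV⟩
  have hcover : ∀ ξ, ∃ U, ξ ∈ A U := by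
    intro ξ
    have hfinF : (F ξ \ {ξ}).Finite := by
      refine (hfin (MulAction.stabilizer G ξ)).subset ?_
      rintro η ⟨h, -⟩
      exact ((hF ξ η).1 h).symm
    obtain ⟨U, hU, hξU, hUs⟩ := hbasis.exists_subset_of_mem_open
      (show ξ ∈ (F ξ \ {ξ})ᶜ from fun h => h.2 rfl) hfinF.isClosed.isOpen_compl
    refine ⟨⟨U, hU⟩, hξU, Set.mem_iInter.2 fun V hVU => ?_⟩
    by_cases hξV : ξ ∈ (V : Set (ℕ → X))
    · exact Or.inl hξV
    · right
      rw [Set.eq_empty_iff_forall_notMem]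
      rintro η ⟨h1, h2⟩
      exact hUs (hVU h2) ⟨h1, fun h => hξV (h ▸ h2)⟩
  have hBU : B = ⋃ U, B ∩ A U := by
    ext ξ
    simp only [Set.mem_iUnion, Set.mem_inter_iff]
    exact ⟨fun h => (hcover ξ).imp fun U hU => ⟨h, hU⟩, fun ⟨_, h, _⟩ => h⟩
  rw [hBU, Set.image_iUnion]
  refine MeasurableSet.iUnion fun U => ?_
  refine MeasurableSet.image_of_measurable_injOn (hB.inter (hAm U)) hmeas ?_
  intro ξ hξ η hη h
  exact (hAF U ξ hξ.2 η ((hF ξ η).2 h) hη.2.1).symm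
end
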